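/- Define μ_r = c_r/τ where c_1 = ρ, c_r = ρΦ(c_{r-1}), under the standard assumptions on Φ, τ, ρ. Then μ_r = 1 − 2/(ρτΦ''(τ)) · r^{−1} + o(r^{−1}) as r → ∞. -/

import Mathlib

open Filter Topology

/-- If `d` decreases to `0` through `d (n + 1) = d n - d n ^ 2 * b n` with `b n → B > 0`, then
`d n` is asymptotically `1 / (B n)`. -/
theorem tendsto_mul_of_quadratic_recurrence {d b : ℕ → ℝ} {B : ℝ} (hB : 0 < B)
    (hd : ∀ n, 0 < d n) (hrec : ∀ n, d (n + 1) = d n - d n ^ 2 * b n)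
    (hd0 : Tendsto d atTop (𝓝 0)) (hb : Tendsto b atTop (𝓝 B)) :
    Tendsto (fun n : ℕ => (n : ℝ) * d n) atTop (𝓝 B⁻¹) := by
  have hstep : ∀ n, (d (n + 1))⁻¹ - (d n)⁻¹ = b n / (1 - d n * b n) := by
    intro n
    have h1 := (hd n).ne'
    have hfac : d (n + 1) = d n * (1 - d n * b n) := by rw [hrec]; ring
    have h2 : 1 - d n * b n ≠ 0 := by
      intro h
      have := (hd (n + 1)).ne'
      simp [hfac, h] at this
    rw [hfac]
    field_simp
    ring
  have hinc : Tendsto (fun n => (d (n + 1))⁻¹ - (d n)⁻¹) atTop (𝓝 B) := by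
    simp only [hstep]
    have hden : Tendsto (fun n => 1 - d n * b n) atTop (𝓝 1) := by
      simpa using (hd0.mul hb).const_sub 1
    exact div_one B ▸ hb.div hden one_ne_zero
  have hces : Tendsto (fun n : ℕ => (n : ℝ)⁻¹ * ((d n)⁻¹ - (d 0)⁻¹)) atTop (𝓝 B) := by
    simpa only [Finset.sum_range_sub (fun n => (d n)⁻¹)] using hinc.cesaro
  have hmain : Tendsto (fun n : ℕ => (n : ℝ)⁻¹ * (d n)⁻¹) atTop (𝓝 B) := by
    have h0 : Tendsto (fun n : ℕ => (n : ℝ)⁻¹ * (d 0)⁻¹) atTop (𝓝 0) := by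
      simpa using (tendsto_natCast_atTop_atTop (R := ℝ)).inv_tendsto_atTop.mul_const (d 0)⁻¹
    simpa [mul_sub] using hces.add h0
  simpa [mul_comm] using hmain.inv₀ hB.ne'

/-- The quotient of `x ^ k - a ^ k + k * a ^ (k - 1) * (a - x)` by `(a - x) ^ 2`. -/
def powRemainder (a : ℝ) (k : ℕ) (x : ℝ) : ℝ :=
  ∑ i ∈ Finset.range k, a ^ (k - 1 - i) * ∑ j ∈ Finset.range i, x ^ j * a ^ (i - 1 - j)

theorem pow_eq_taylor_add_powRemainder (a x : ℝ) (k : ℕ) :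
    x ^ k = a ^ k - k * a ^ (k - 1) * (a - x) + (a - x) ^ 2 * powRemainder a k x := by
  have hgeom (n : ℕ) : (a - x) * ∑ j ∈ Finset.range n, x ^ j * a ^ (n - 1 - j) = a ^ n - x ^ n := by
    linear_combination -geom_sum₂_mul x a n
  have hinner : (a - x) * powRemainder a k x
      = k * a ^ (k - 1) - ∑ i ∈ Finset.range k, x ^ i * a ^ (k - 1 - i) := by
    have hconst : (k : ℝ) * a ^ (k - 1) = ∑ _i ∈ Finset.range k, a ^ (k - 1) := by simp
    rw [hconst, ← Finset.sum_sub_distrib, powRemainder, Finset.mul_sum]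
    refine Finset.sum_congr rfl fun i hi => ?_
    have hpow : a ^ (k - 1) = a ^ (k - 1 - i) * a ^ i := by
      rw [← pow_add]
      congr 1
      have := Finset.mem_range.mp hi
      omega
    rw [hpow]
    linear_combination a ^ (k - 1 - i) * hgeom i
  linear_combination (x - a) * hinner + hgeom k

theorem powRemainder_self (a : ℝ) (k : ℕ) :
    powRemainder a k a = k * (k - 1) / 2 * a ^ (k - 2) := by
  have hinner : ∀ i ∈ Finset.range k,
      a ^ (k - 1 - i) * ∑ j ∈ Finset.range i, a ^ j * a ^ (i - 1 - j) = i * a ^ (k - 2) := by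
    intro i hi
    have hterm : ∀ j ∈ Finset.range i, a ^ (k - 1 - i) * (a ^ j * a ^ (i - 1 - j)) = a ^ (k - 2) := by
      intro j hj
      rw [← pow_add, ← pow_add]
      congr 1
      have := Finset.mem_range.mp hi
      have := Finset.mem_range.mp hj
      omega
    rw [Finset.mul_sum, Finset.sum_congr rfl hterm]
    simp
  rw [powRemainder, Finset.sum_congr rfl hinner, ← Finset.sum_mul]
  congr 1
  clear hinner
  induction k with
  | zero => simp
  | succ k ih => rw [Finset.sum_range_succ, ih]; push_cast; ring

theorem continuous_powRemainder (a : ℝ) (k : ℕ) : Continuous (powRemainder a k) := by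
  unfold powRemainder
  fun_prop

theorem powRemainder_mono {a x y : ℝ} (ha : 0 ≤ a) (hx : 0 ≤ x) (hxy : x ≤ y) (k : ℕ) :
    powRemainder a k x ≤ powRemainder a k y := by
  unfold powRemainder
  gcongr

theorem powRemainder_nonneg {a x : ℝ} (ha : 0 ≤ a) (hx : 0 ≤ x) (k : ℕ) :
    0 ≤ powRemainder a k x := by
  unfold powRemainder
  positivity

theorem powRemainder_pos {a x : ℝ} (ha : 0 < a) (hx : 0 ≤ x) {k : ℕ} (hk : 1 < k) :
    0 < powRemainder a k x := by
  unfold powRemainder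
  refine Finset.sum_pos' (fun i _ => by positivity) ⟨1, Finset.mem_range.mpr hk, ?_⟩
  simp only [Finset.sum_range_one]
  positivity

theorem summable_sq_mul_pow_of_lt {w : ℕ → ℝ} {a s : ℝ} (ha : 0 < a)
    (has : a < s) (hs : Summable fun k => w k * s ^ k) :
    Summable fun k : ℕ => (k : ℝ) ^ 2 * (w k * a ^ k) := by
  have hs0 : 0 < s := ha.trans has
  have hlim : Tendsto (fun k : ℕ => (k : ℝ) ^ 2 * (a / s) ^ k) atTop (𝓝 0) :=
    tendsto_pow_const_mul_const_pow_of_lt_one 2 (by positivity) ((div_lt_one hs0).mpr has)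
  refine summable_of_isBigO_nat hs ?_
  have := (hlim.isBigO_one ℝ).mul (Asymptotics.isBigO_refl (fun k => w k * s ^ k) atTop)
  refine (this.congr_left fun k => ?_).congr_right fun k => one_mul _
  rw [div_pow]
  field_simp

open Filter Topology

/-- Under the standard assumptions on `Φ`, `τ`, `ρ`, the constants `μ_r = c_r/τ`
(with `c_1 = ρ`, `c_r = ρΦ(c_{r-1})`) satisfy
`μ_r = 1 − 2/(ρτΦ''(τ)) · r⁻¹ + o(r⁻¹)` as `r → ∞`; equivalently
`r·(μ_r − 1) → −2/(ρτΦ''(τ))`. -/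
theorem mu_asymptotics (w : ℕ → ℝ) (hw : ∀ k, 0 ≤ w k) (hw0 : w 0 = 1)
    (hwk : ∃ k, 1 < k ∧ 0 < w k)
    (τ : ℝ) (hτ : 0 < τ)
    (hrad : ∃ s, τ < s ∧ Summable fun k => w k * s ^ k)
    (Φ Φd : ℝ → ℝ) (Φdd : ℝ)
    (hΦ : ∀ t, Φ t = ∑' k : ℕ, w k * t ^ k)
    (hΦd : ∀ t, Φd t = ∑' k : ℕ, (k : ℝ) * w k * t ^ (k - 1))
    (hΦdd : Φdd = ∑' k : ℕ, (k : ℝ) * ((k : ℝ) - 1) * w k * τ ^ (k - 2))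
    (hcrit : Φ τ = τ * Φd τ)
    (ρ : ℝ) (hρ : ρ = τ / Φ τ)
    (c : ℕ → ℝ) (hc1 : c 1 = ρ) (hcrec : ∀ r, 1 ≤ r → c (r + 1) = ρ * Φ (c r))
    (μ : ℕ → ℝ) (hμ : ∀ r, μ r = c r / τ) :
    Tendsto (fun r : ℕ => (r : ℝ) * (μ r - 1)) atTop (𝓝 (-(2 / (ρ * τ * Φdd)))) := by
  obtain ⟨s, hτs, hs⟩ := hrad
  obtain ⟨m, hm, hwm⟩ := hwk
  have hsq := summable_sq_mul_pow_of_lt hτ hτs hs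
  have hsum : Summable fun k => w k * τ ^ k :=
    hs.of_nonneg_of_le (fun k => mul_nonneg (hw k) (by positivity))
      fun k => mul_le_mul_of_nonneg_left (pow_le_pow_left₀ hτ.le hτs.le k) (hw k)
  have hsum_d : Summable fun k : ℕ => (k : ℝ) * w k * τ ^ (k - 1) := by
    refine (hsq.mul_right τ⁻¹).of_nonneg_of_le
      (fun k => mul_nonneg (mul_nonneg (by positivity) (hw k)) (by positivity)) fun k => ?_
    rcases k with _ | k
    · simp
    · have h1 : (1 : ℝ) ≤ (k + 1 : ℕ) := by exact_mod_cast Nat.succ_le_succ (Nat.zero_le k)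
      have h2 : 0 ≤ w (k + 1) * τ ^ k := mul_nonneg (hw _) (by positivity)
      have h3 : ((k + 1 : ℕ) : ℝ) ^ 2 * (w (k + 1) * τ ^ (k + 1)) * τ⁻¹
          = ((k + 1 : ℕ) : ℝ) ^ 2 * (w (k + 1) * τ ^ k) := by
        field_simp
        ring
      rw [h3, Nat.add_sub_cancel]
      nlinarith [mul_nonneg (mul_nonneg (sub_nonneg.mpr h1) (zero_le_one.trans h1)) h2]
  have hsum_rem : Summable fun k => w k * powRemainder τ k τ := by
    refine (hsq.mul_right (τ ^ 2)⁻¹).of_nonneg_of_le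
      (fun k => mul_nonneg (hw k) (powRemainder_nonneg hτ.le hτ.le k)) fun k => ?_
    rw [powRemainder_self]
    rcases k with _ | _ | k
    · simp
    · simpa using mul_nonneg (mul_nonneg (hw 1) hτ.le) (by positivity)
    · have h2 : 0 ≤ w (k + 2) * τ ^ k := mul_nonneg (hw _) (by positivity)
      have h3 : ((k + 2 : ℕ) : ℝ) ^ 2 * (w (k + 2) * τ ^ (k + 2)) * (τ ^ 2)⁻¹
          = ((k + 2 : ℕ) : ℝ) ^ 2 * (w (k + 2) * τ ^ k) := by
        field_simp
        ring
      have h4 : (0 : ℝ) ≤ ((k + 2 : ℕ) : ℝ) := by positivity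
      show w (k + 2) * (((k + 2 : ℕ) : ℝ) * (((k + 2 : ℕ) : ℝ) - 1) / 2 * τ ^ k)
        ≤ ((k + 2 : ℕ) : ℝ) ^ 2 * (w (k + 2) * τ ^ (k + 2)) * (τ ^ 2)⁻¹
      rw [h3]
      generalize ((k + 2 : ℕ) : ℝ) = n at h4 ⊢
      nlinarith [mul_nonneg (by nlinarith : 0 ≤ n ^ 2 + n) h2]
  have hrem_nonneg : ∀ x, 0 ≤ x → ∀ k, 0 ≤ w k * powRemainder τ k x := fun x hx k =>
    mul_nonneg (hw k) (powRemainder_nonneg hτ.le hx k)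
  have hrem_le : ∀ x, 0 ≤ x → x ≤ τ → ∀ k,
      w k * powRemainder τ k x ≤ w k * powRemainder τ k τ := fun x hx hxτ k =>
    mul_le_mul_of_nonneg_left (powRemainder_mono hτ.le hx hxτ k) (hw k)
  have hrem_summable : ∀ x, 0 ≤ x → x ≤ τ → Summable fun k => w k * powRemainder τ k x :=
    fun x hx hxτ => hsum_rem.of_nonneg_of_le (hrem_nonneg x hx) (hrem_le x hx hxτ)
  set Q : ℝ → ℝ := fun x => ∑' k, w k * powRemainder τ k x with hQ
  have hQpos : ∀ x, 0 ≤ x → x ≤ τ → 0 < Q x := fun x hx hxτ =>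
    (hrem_summable x hx hxτ).tsum_pos (hrem_nonneg x hx) m
      (mul_pos hwm (powRemainder_pos hτ hx hm))
  have hQcont : ContinuousOn Q (Set.Icc 0 τ) := by
    refine continuousOn_tsum
      (fun k => ((continuous_powRemainder τ k).const_mul (w k)).continuousOn) hsum_rem ?_
    intro k x hx
    rw [Real.norm_of_nonneg (hrem_nonneg x hx.1 k)]
    exact hrem_le x hx.1 hx.2 k
  have hQτ : Q τ = Φdd / 2 := by
    rw [hΦdd, hQ, ← tsum_div_const]
    refine tsum_congr fun k => ?_
    rw [powRemainder_self]
    ring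
  have hΦτ_ge : 1 ≤ Φ τ := by
    have := hsum.le_tsum 0 fun k _ => mul_nonneg (hw k) (by positivity)
    simpa [hΦ, hw0] using this
  have hΦτ : 0 < Φ τ := one_pos.trans_le hΦτ_ge
  have hρ0 : 0 < ρ := by rw [hρ]; positivity
  have hρΦ : ρ * Φ τ = τ := by rw [hρ]; field_simp
  have htaylor : ∀ x, 0 ≤ x → x ≤ τ → ρ * Φ x = x + (τ - x) ^ 2 * (ρ * Q x) := by
    intro x hx hxτ
    have hΦx : Φ x = Φ τ - Φd τ * (τ - x) + (τ - x) ^ 2 * Q x := by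
      rw [hΦ x, hΦ τ, hΦd, hQ, ← tsum_mul_right, ← tsum_mul_left,
        ← hsum.tsum_sub (hsum_d.mul_right _),
        ← (hsum.sub (hsum_d.mul_right _)).tsum_add ((hrem_summable x hx hxτ).mul_left _)]
      refine tsum_congr fun k => ?_
      rw [pow_eq_taylor_add_powRemainder τ x k]
      ring
    have hρΦd : ρ * Φd τ = 1 := by
      have : τ * (ρ * Φd τ) = τ * 1 := by linear_combination hρΦ - ρ * hcrit
      exact mul_left_cancel₀ hτ.ne' this
    rw [hΦx]
    linear_combination hρΦ - (τ - x) * hρΦd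
  have hΦ_lt : ∀ x, 0 ≤ x → x < τ → Φ x < Φ τ := by
    intro x hx hxτ
    have hle : ∀ k, w k * x ^ k ≤ w k * τ ^ k := fun k =>
      mul_le_mul_of_nonneg_left (pow_le_pow_left₀ hx hxτ.le k) (hw k)
    rw [hΦ, hΦ]
    exact Summable.tsum_lt_tsum hle
      (mul_lt_mul_of_pos_left (pow_lt_pow_left₀ hxτ hx (by omega)) hwm)
      (hsum.of_nonneg_of_le (fun k => mul_nonneg (hw k) (by positivity)) hle) hsum
  have hstep_lt : ∀ x, 0 ≤ x → x < τ → ρ * Φ x < τ := fun x hx hxτ =>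
    (mul_lt_mul_of_pos_left (hΦ_lt x hx hxτ) hρ0).trans_eq hρΦ
  have hmem : ∀ n, 0 ≤ c (n + 1) ∧ c (n + 1) < τ := by
    intro n
    induction n with
    | zero =>
      have hΦ0 : Φ 0 = 1 := by
        rw [hΦ, tsum_eq_single 0 fun k hk => by simp [hk]]
        simp [hw0]
      have := hstep_lt 0 le_rfl hτ
      rw [hΦ0, mul_one] at this
      simpa [hc1] using And.intro hρ0.le this
    | succ n ih =>
      rw [hcrec (n + 1) (by omega)]
      refine ⟨?_, hstep_lt _ ih.1 ih.2⟩
      rw [htaylor _ ih.1 ih.2.le]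
      have := hQpos _ ih.1 ih.2.le
      have := ih.1
      positivity
  have hrec : ∀ n, c (n + 1 + 1) = c (n + 1) + (τ - c (n + 1)) ^ 2 * (ρ * Q (c (n + 1))) :=
    fun n => by rw [hcrec (n + 1) (by omega), htaylor _ (hmem n).1 (hmem n).2.le]
  have hmono : Monotone fun n => c (n + 1) := by
    refine monotone_nat_of_le_succ fun n => ?_
    have := hQpos _ (hmem n).1 (hmem n).2.le
    rw [hrec n]
    exact le_add_of_nonneg_right (by positivity)
  obtain ⟨L, hL⟩ : ∃ L, Tendsto (fun n => c (n + 1)) atTop (𝓝 L) :=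
    ⟨_, tendsto_atTop_ciSup hmono ⟨τ, by rintro _ ⟨n, rfl⟩; exact (hmem n).2.le⟩⟩
  have hL0 : 0 ≤ L := ge_of_tendsto' hL fun n => (hmem n).1
  have hLτ : L ≤ τ := le_of_tendsto' hL fun n => (hmem n).2.le
  have hQL : Tendsto (fun n => Q (c (n + 1))) atTop (𝓝 (Q L)) :=
    (hQcont L ⟨hL0, hLτ⟩).tendsto.comp
      (tendsto_nhdsWithin_iff.mpr ⟨hL, .of_forall fun n => ⟨(hmem n).1, (hmem n).2.le⟩⟩)
  have hfix : L = L + (τ - L) ^ 2 * (ρ * Q L) := by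
    refine tendsto_nhds_unique ((tendsto_add_atTop_iff_nat 1).mpr hL) ?_
    simp only [hrec]
    exact hL.add (((tendsto_const_nhds.sub hL).pow 2).mul (hQL.const_mul ρ))
  obtain rfl : L = τ := by
    have hz : (τ - L) ^ 2 * (ρ * Q L) = 0 := by linarith
    have := pow_eq_zero_iff two_ne_zero |>.mp
      ((mul_eq_zero.mp hz).resolve_right (mul_pos hρ0 (hQpos L hL0 hLτ)).ne')
    linarith
  have hd0 : Tendsto (fun n => L - c (n + 1)) atTop (𝓝 0) := by
    simpa using hL.const_sub L
  have hlim := tendsto_mul_of_quadratic_recurrence (mul_pos hρ0 (hQpos L hL0 le_rfl))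
    (fun n => sub_pos.mpr (hmem n).2) (fun n => by rw [hrec]; ring) hd0 (hQL.const_mul ρ)
  rw [← tendsto_add_atTop_iff_nat 1]
  have hres := ((hlim.add hd0).div_const L).neg
  rw [hQτ, add_zero] at hres
  convert hres using 1
  · funext n
    rw [hμ]
    push_cast
    field_simp
    ring
  · congr 1
    have : Φdd ≠ 0 := by
      have := (hQpos L hL0 le_rfl).ne'
      rintro rfl
      simp [hQτ] at this
    field_simp
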